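/- The norm closure of the set {A G : G invertible in B(H)} of right-multiples of A ∈ B(H,K) by invertible operators contains every operator of the form A' where A' agrees with (a unitary-conjugated copy of) A on a subspace on which A is bounded below; in particular: for every A ∈ B(H,K), every C ∈ B(H,K) such that every triple (dim(H⊖V), dim V, dim(K⊖C(V))) arising from a subspace V on which C is bounded below also arises from some subspace on which A is bounded below, lies in the norm closure of {G₂ A G₁⁻¹ : G₁ ∈ G(H), G₂ ∈ G(K)}. -/

import Mathlib

/-- The Hilbert dimension of an inner product space: the supremum of cardinalities of
orthonormal subsets. -/
noncomputable def hdim (𝕜 E : Type*) [RCLike 𝕜] [NormedAddCommGroup E]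
    [InnerProductSpace 𝕜 E] : Cardinal :=
  ⨆ s : {s : Set E // Orthonormal 𝕜 (fun x : s => (x : E))}, Cardinal.mk s.1

variable {H K : Type u} [NormedAddCommGroup H] [InnerProductSpace ℂ H] [CompleteSpace H]
  [NormedAddCommGroup K] [InnerProductSpace ℂ K] [CompleteSpace K]

/-- `Υ(A)`: the closed subspaces of `H` on which `A` is bounded below. -/
def UpsilonMem (A : H →L[ℂ] K) (V : Submodule ℂ H) : Prop :=
  IsClosed (V : Set H) ∧ ∃ c : ℝ, 0 < c ∧ ∀ x ∈ V, c * ‖x‖ ≤ ‖A x‖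

/-- `ξ_A(V) = (dim (H ⊖ V), dim V, dim (K ⊖ A(V)))`. -/
noncomputable def xiOp (A : H →L[ℂ] K) (V : Submodule ℂ H) :
    Cardinal × Cardinal × Cardinal :=
  (hdim ℂ ↥Vᗮ, hdim ℂ ↥V, hdim ℂ ↥(Submodule.map A.toLinearMap V)ᗮ)

/-- `Λ(A) = {ξ_A(V) : V ∈ Υ(A)}`. -/
def LambdaOp (A : H →L[ℂ] K) : Set (Cardinal × Cardinal × Cardinal) :=
  {t | ∃ V : Submodule ℂ H, UpsilonMem A V ∧ t = xiOp A V}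

open scoped InnerProductSpace

section HilbertDimension

variable {𝕜 : Type*} [RCLike 𝕜] {E F : Type u} [NormedAddCommGroup E] [InnerProductSpace 𝕜 E]
  [NormedAddCommGroup F] [InnerProductSpace 𝕜 F]

/-- An orthonormal set has at most as many elements as a Hilbert basis. -/
theorem Orthonormal.mk_le_mk_hilbertBasis {ι : Type u} (b : HilbertBasis ι 𝕜 E) {s : Set E}
    (hs : Orthonormal 𝕜 (fun x : s => (x : E))) : Cardinal.mk s ≤ Cardinal.mk ι := by
  rcases finite_or_infinite ι with hι | hι
  · have := Fintype.ofFinite ι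
    rw [Cardinal.mk_fintype ι, ← rank_eq_card_basis b.toOrthonormalBasis.toBasis]
    exact hs.linearIndependent.cardinal_le_rank
  · have hcount (i : ι) : {x : s | ⟪(x : E), b i⟫_𝕜 ≠ 0}.Countable := by
      refine (hs.inner_products_summable (b i)).countable_support.mono fun x hx => ?_
      simpa using hx
    have hcover : ⋃ i, {x : s | ⟪(x : E), b i⟫_𝕜 ≠ 0} = Set.univ := by
      refine Set.eq_univ_of_forall fun x => ?_
      by_contra hx
      have hx' : ∀ i, ⟪(x : E), b i⟫_𝕜 = 0 := by simpa using hx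
      refine hs.ne_zero x (b.repr.injective ?_)
      ext i
      rw [b.repr_apply_apply, inner_eq_zero_symm.mp (hx' i)]
      simp
    calc Cardinal.mk s = Cardinal.mk (⋃ i, {x : s | ⟪(x : E), b i⟫_𝕜 ≠ 0} : Set s) := by
          rw [hcover, Cardinal.mk_univ]
      _ ≤ Cardinal.mk ι * ⨆ i, Cardinal.mk {x : s | ⟪(x : E), b i⟫_𝕜 ≠ 0} :=
          Cardinal.mk_iUnion_le _
      _ ≤ Cardinal.mk ι * Cardinal.aleph0 := by
          gcongr
          exact ciSup_le' fun i => Cardinal.mk_le_aleph0_iff.mpr (hcount i).to_subtype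
      _ = Cardinal.mk ι := Cardinal.mul_aleph0_eq (Cardinal.infinite_iff.mp hι)

/-- A complete space has a Hilbert basis whose cardinality is the Hilbert dimension. -/
theorem exists_hilbertBasis_mk_eq_hdim (𝕜 : Type*) [RCLike 𝕜] (E : Type u)
    [NormedAddCommGroup E] [InnerProductSpace 𝕜 E] [CompleteSpace E] :
    ∃ (w : Set E) (_ : HilbertBasis w 𝕜 E), Cardinal.mk w = hdim 𝕜 E := by
  obtain ⟨w, b, hb⟩ := exists_hilbertBasis 𝕜 E
  have hw : Orthonormal 𝕜 (fun x : w => (x : E)) := hb ▸ b.orthonormal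
  refine ⟨w, b, le_antisymm ?_ (ciSup_le' fun s => s.2.mk_le_mk_hilbertBasis b)⟩
  exact le_ciSup (f := fun s : {s : Set E // Orthonormal 𝕜 (fun x : s => (x : E))} =>
    Cardinal.mk s.1) Cardinal.bddAbove_of_small ⟨w, hw⟩

/-- Hilbert spaces of the same Hilbert dimension are isometrically isomorphic. -/
theorem nonempty_linearIsometryEquiv_of_hdim_eq [CompleteSpace E] [CompleteSpace F]
    (h : hdim 𝕜 E = hdim 𝕜 F) : Nonempty (E ≃ₗᵢ[𝕜] F) := by
  obtain ⟨w, b, hw⟩ := exists_hilbertBasis_mk_eq_hdim 𝕜 E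
  obtain ⟨v, c, hv⟩ := exists_hilbertBasis_mk_eq_hdim 𝕜 F
  obtain ⟨e⟩ := Cardinal.eq.mp (hw.trans (h.trans hv.symm))
  let c' : HilbertBasis w 𝕜 F := HilbertBasis.mk (c.orthonormal.comp e e.injective) <| by
    rw [e.surjective.range_comp, c.dense_span]
  exact ⟨b.repr.trans c'.repr.symm⟩

end HilbertDimension

section OrthogonalGluing

variable {𝕜 E F : Type*} [RCLike 𝕜] [NormedAddCommGroup E] [InnerProductSpace 𝕜 E]
  [NormedAddCommGroup F] [InnerProductSpace 𝕜 F]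

/-- The map acting as `e` on `V` and as `f` on `Vᗮ`. -/
noncomputable def Submodule.orthogonalGlue (V : Submodule 𝕜 E) (W : Submodule 𝕜 F)
    [V.HasOrthogonalProjection] (e : V →L[𝕜] W) (f : Vᗮ →L[𝕜] Wᗮ) : E →L[𝕜] F :=
  W.subtypeL ∘L e ∘L V.orthogonalProjectionOnto +
    Wᗮ.subtypeL ∘L f ∘L Vᗮ.orthogonalProjectionOnto

theorem Submodule.orthogonalGlue_apply_coe (V : Submodule 𝕜 E) (W : Submodule 𝕜 F)
    [V.HasOrthogonalProjection] (e : V →L[𝕜] W) (f : Vᗮ →L[𝕜] Wᗮ) (x : V) :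
    V.orthogonalGlue W e f x = e x := by
  have : Vᗮ.orthogonalProjectionOnto (x : E) = 0 :=
    Submodule.orthogonalProjectionOnto_orthogonal_apply_eq_zero x.2
  simp [orthogonalGlue, this]

theorem Submodule.orthogonalGlue_apply_coe_orthogonal (V : Submodule 𝕜 E) (W : Submodule 𝕜 F)
    [V.HasOrthogonalProjection] (e : V →L[𝕜] W) (f : Vᗮ →L[𝕜] Wᗮ) (x : Vᗮ) :
    V.orthogonalGlue W e f x = f x := by
  have : V.orthogonalProjectionOnto (x : E) = 0 :=
    by
    simp
  simp [orthogonalGlue, this]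

theorem Submodule.orthogonalGlue_leftInverse (V : Submodule 𝕜 E) (W : Submodule 𝕜 F)
    [V.HasOrthogonalProjection] [W.HasOrthogonalProjection] (e : V ≃L[𝕜] W) (f : Vᗮ ≃L[𝕜] Wᗮ) :
    Function.LeftInverse (W.orthogonalGlue V (e.symm : W →L[𝕜] V) (f.symm : Wᗮ →L[𝕜] Vᗮ))
      (V.orthogonalGlue W (e : V →L[𝕜] W) (f : Vᗮ →L[𝕜] Wᗮ)) := by
  intro x
  obtain ⟨y, hy, z, hz, rfl⟩ := V.exists_add_mem_mem_orthogonal x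
  lift y to V using hy
  lift z to Vᗮ using hz
  simp [orthogonalGlue_apply_coe, orthogonalGlue_apply_coe_orthogonal]

/-- The invertible map acting as `e` on `V` and as `f` on `Vᗮ`. -/
noncomputable def Submodule.orthogonalGlueEquiv (V : Submodule 𝕜 E) (W : Submodule 𝕜 F)
    [V.HasOrthogonalProjection] [W.HasOrthogonalProjection] (e : V ≃L[𝕜] W) (f : Vᗮ ≃L[𝕜] Wᗮ) :
    E ≃L[𝕜] F :=
  .equivOfInverse (V.orthogonalGlue W (e : V →L[𝕜] W) (f : Vᗮ →L[𝕜] Wᗮ))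
    (W.orthogonalGlue V (e.symm : W →L[𝕜] V) (f.symm : Wᗮ →L[𝕜] Vᗮ))
    (V.orthogonalGlue_leftInverse W e f)
    (W.orthogonalGlue_leftInverse V e.symm f.symm)

theorem Submodule.orthogonalGlueEquiv_apply_coe (V : Submodule 𝕜 E) (W : Submodule 𝕜 F)
    [V.HasOrthogonalProjection] [W.HasOrthogonalProjection] (e : V ≃L[𝕜] W) (f : Vᗮ ≃L[𝕜] Wᗮ)
    (x : V) : V.orthogonalGlueEquiv W e f x = e x :=
  V.orthogonalGlue_apply_coe W _ _ x

theorem Submodule.orthogonalGlueEquiv_apply_coe_orthogonal (V : Submodule 𝕜 E)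
    (W : Submodule 𝕜 F) [V.HasOrthogonalProjection] [W.HasOrthogonalProjection] (e : V ≃L[𝕜] W)
    (f : Vᗮ ≃L[𝕜] Wᗮ) (x : Vᗮ) : V.orthogonalGlueEquiv W e f x = f x :=
  V.orthogonalGlue_apply_coe_orthogonal W _ _ x

end OrthogonalGluing

section BoundedBelow

variable {E F : Type u} [NormedAddCommGroup E] [InnerProductSpace ℂ E]
  [NormedAddCommGroup F] [InnerProductSpace ℂ F]

/-- An operator bounded below on `V` is an isomorphism of `V` onto its image. -/
theorem UpsilonMem.exists_equiv_map {A : E →L[ℂ] F} {V : Submodule ℂ E} (hV : UpsilonMem A V) :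
    ∃ e : V ≃L[ℂ] Submodule.map A.toLinearMap V, ∀ x : V, (e x : F) = A x := by
  obtain ⟨-, c, hc, hA⟩ := hV
  have hinj : Function.Injective (A.toLinearMap.domRestrict V) := by
    rw [← LinearMap.ker_eq_bot, LinearMap.ker_eq_bot']
    intro x hx
    have hx' : A x = 0 := hx
    have := hA x x.2
    rw [hx', norm_zero] at this
    have : ‖(x : E)‖ ≤ 0 := by nlinarith [norm_nonneg (x : E)]
    simpa using this
  let e₀ : V ≃ₗ[ℂ] Submodule.map A.toLinearMap V :=
    (LinearEquiv.ofInjective _ hinj).trans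
      (LinearEquiv.ofEq _ _ (LinearMap.range_domRestrict V A.toLinearMap))
  have he (x : V) : (e₀ x : F) = A x := rfl
  refine ⟨e₀.toContinuousLinearEquivOfBounds ‖A‖ c⁻¹ (fun x => ?_) (fun y => ?_), he⟩
  · exact A.le_opNorm x
  · obtain ⟨x, rfl⟩ := e₀.surjective y
    rw [LinearEquiv.symm_apply_apply, inv_mul_eq_div, le_div_iff₀' hc]
    exact hA x x.2

theorem UpsilonMem.completeSpace_map [CompleteSpace E] {A : E →L[ℂ] F} {V : Submodule ℂ E}
    (hV : UpsilonMem A V) : CompleteSpace (Submodule.map A.toLinearMap V) := by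
  have : CompleteSpace V := hV.1.completeSpace_coe
  obtain ⟨e, -⟩ := hV.exists_equiv_map
  exact (completeSpace_congr (e := e.toEquiv) e.isUniformEmbedding).mp this

/-- For every `ε > 0` there is a closed subspace on which `C` is bounded below and such that `C`
has norm at most `ε` on its orthogonal complement. -/
theorem exists_upsilonMem_norm_le_orthogonal (C : H →L[ℂ] K) {ε : ℝ} (hε : 0 < ε) :
    ∃ V : Submodule ℂ H, UpsilonMem C V ∧ ∀ x ∈ Vᗮ, ‖C x‖ ≤ ε * ‖x‖ := by
  let S : H →L[ℂ] H := C.adjoint ∘L C - ((ε ^ 2 : ℝ) : ℂ) • ContinuousLinearMap.id ℂ H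
  have hS : IsSelfAdjoint S := by
    refine IsSelfAdjoint.sub (C.isPositive_adjoint_comp_self).isSelfAdjoint ?_
    exact IsSelfAdjoint.smul (Complex.conj_ofReal _) (IsSelfAdjoint.one (H →L[ℂ] H))
  have hre (x : H) : RCLike.re ⟪S x, x⟫_ℂ = ‖C x‖ ^ 2 - ε ^ 2 * ‖x‖ ^ 2 := by
    have h1 : RCLike.re ⟪C x, C x⟫_ℂ = ‖C x‖ ^ 2 := inner_self_eq_norm_sq _
    have h2 : RCLike.re ⟪x, x⟫_ℂ = ‖x‖ ^ 2 := inner_self_eq_norm_sq _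
    rw [← h1, ← h2]
    simp only [S, sub_apply, ContinuousLinearMap.comp_apply,
      smul_apply, ContinuousLinearMap.id_apply, inner_sub_left,
      ContinuousLinearMap.adjoint_inner_left, inner_smul_left, Complex.conj_ofReal, map_sub]
    congr 1
    exact Complex.re_ofReal_mul _ _
  have hsub : S⁺ - S⁻ = S := CFC.posPart_sub_negPart S hS
  have hpos : (S⁺).IsPositive :=
    (ContinuousLinearMap.nonneg_iff_isPositive _).mp (CFC.posPart_nonneg S)
  have hneg : (S⁻).IsPositive :=
    (ContinuousLinearMap.nonneg_iff_isPositive _).mp (CFC.negPart_nonneg S)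
  have hsub_apply (y : H) : S y = S⁺ y - S⁻ y := DFunLike.congr_fun hsub.symm y
  have hmul (z : H) : S⁻ (S⁺ z) = 0 :=
    DFunLike.congr_fun (CFC.negPart_mul_posPart S) z
  have hlow : ∀ x ∈ (LinearMap.range S⁺.toLinearMap).topologicalClosure, ε * ‖x‖ ≤ ‖C x‖ := by
    have hclosed : IsClosed {x : H | ε * ‖x‖ ≤ ‖C x‖} :=
      isClosed_le (by fun_prop) (by fun_prop)
    intro x hx
    refine closure_minimal ?_ hclosed hx
    rintro _ ⟨z, rfl⟩
    have h1 : S (S⁺ z) = S⁺ (S⁺ z) := by rw [hsub_apply, hmul, sub_zero]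
    have h2 := hre (S⁺ z)
    rw [h1] at h2
    have h3 := hpos.re_inner_nonneg_left (S⁺ z)
    have h4 : (ε * ‖S⁺ z‖) ^ 2 ≤ ‖C (S⁺ z)‖ ^ 2 := by rw [mul_pow]; linarith
    exact le_of_sq_le_sq h4 (norm_nonneg _)
  refine ⟨(LinearMap.range S⁺.toLinearMap).topologicalClosure,
    ⟨Submodule.isClosed_topologicalClosure _, ε, hε, hlow⟩, fun x hx => ?_⟩
  rw [Submodule.orthogonal_closure] at hx
  have hx0 : S⁺ x = 0 := by
    have := (S⁺).orthogonal_range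
    rw [hpos.isSelfAdjoint.adjoint_eq] at this
    exact (this ▸ hx :)
  have h1 : S x = - S⁻ x := by rw [hsub_apply, hx0, zero_sub]
  have h2 := hre x
  rw [h1, inner_neg_left, map_neg] at h2
  have h3 := hneg.re_inner_nonneg_left x
  have h4 : ‖C x‖ ^ 2 ≤ (ε * ‖x‖) ^ 2 := by rw [mul_pow]; linarith
  exact le_of_sq_le_sq h4 (by positivity)

end BoundedBelow

/-- If `ξ_A(W) = ξ_C(V)`, then for every `η > 0` some member of the two-sided orbit of `A` agrees
with `C` on `V` and has norm at most `η` on `Vᗮ`. -/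
theorem exists_orbit_eq_on_norm_le_orthogonal {A C : H →L[ℂ] K} {V W : Submodule ℂ H}
    (hV : UpsilonMem C V) (hW : UpsilonMem A W) (hξ : xiOp C V = xiOp A W) {η : ℝ} (hη : 0 < η) :
    ∃ (G₁ : H ≃L[ℂ] H) (G₂ : K ≃L[ℂ] K),
      (∀ x ∈ V, G₂ (A (G₁.symm x)) = C x) ∧ ∀ x ∈ Vᗮ, ‖G₂ (A (G₁.symm x))‖ ≤ η * ‖x‖ := by
  have := hV.1.completeSpace_coe
  have := hW.1.completeSpace_coe
  have := hV.completeSpace_map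
  have := hW.completeSpace_map
  obtain ⟨h₁, h₂, h₃⟩ : hdim ℂ ↥Vᗮ = hdim ℂ ↥Wᗮ ∧ hdim ℂ ↥V = hdim ℂ ↥W ∧
      hdim ℂ ↥(Submodule.map C.toLinearMap V)ᗮ = hdim ℂ ↥(Submodule.map A.toLinearMap W)ᗮ := by
    simpa [xiOp] using hξ
  obtain ⟨f⟩ := nonempty_linearIsometryEquiv_of_hdim_eq h₁
  obtain ⟨u⟩ := nonempty_linearIsometryEquiv_of_hdim_eq h₂
  obtain ⟨g⟩ := nonempty_linearIsometryEquiv_of_hdim_eq h₃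
  obtain ⟨a, ha⟩ := hW.exists_equiv_map
  obtain ⟨c, hc⟩ := hV.exists_equiv_map
  let G₂ : K ≃L[ℂ] K := Submodule.orthogonalGlueEquiv _ _
    ((a.symm.trans u.symm.toContinuousLinearEquiv).trans c) g.symm.toContinuousLinearEquiv
  let B : H →L[ℂ] K := (G₂ : K →L[ℂ] K) ∘L A
  let δ : ℝ := η / (‖B‖ + 1)
  have hδ : 0 < δ := by positivity
  have hδB : ‖B‖ * δ ≤ η := by
    have : δ * (‖B‖ + 1) = η := div_mul_cancel₀ _ (by positivity)
    nlinarith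
  let G₁ : H ≃L[ℂ] H := V.orthogonalGlueEquiv W u.toContinuousLinearEquiv
    (f.toContinuousLinearEquiv.trans
      (ContinuousLinearEquiv.smulLeft (Units.mk0 (δ : ℂ) (by exact_mod_cast hδ.ne'))))
  refine ⟨G₁.symm, G₂, fun x hx => ?_, fun x hx => ?_⟩
  · lift x to V using hx
    have h1 : G₁ x = u x := V.orthogonalGlueEquiv_apply_coe W _ _ x
    rw [ContinuousLinearEquiv.symm_symm, h1, ← ha, ← hc]
    refine (Submodule.orthogonalGlueEquiv_apply_coe _ _ _ _ _).trans ?_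
    simp
  · lift x to Vᗮ using hx
    have h1 : G₁ x = (δ : ℂ) • (f x : H) := V.orthogonalGlueEquiv_apply_coe_orthogonal W _ _ x
    rw [ContinuousLinearEquiv.symm_symm, h1]
    calc ‖B ((δ : ℂ) • (f x : H))‖ ≤ ‖B‖ * ‖(δ : ℂ) • (f x : H)‖ := B.le_opNorm _
      _ = ‖B‖ * δ * ‖(x : H)‖ := by
        rw [norm_smul, Complex.norm_real, Real.norm_of_nonneg hδ.le, Submodule.norm_coe,
          f.norm_map, mul_assoc, Submodule.norm_coe]
      _ ≤ η * ‖(x : H)‖ := by gcongr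

/-- If `Λ(C) ⊆ Λ(A)`, then `C` lies in the norm closure of the two-sided orbit
`{G₂ A G₁⁻¹ : G₁ ∈ G(H), G₂ ∈ G(K)}` of `A`. -/
theorem mem_closure_orbit_of_Lambda_subset (A C : H →L[ℂ] K)
    (h : LambdaOp C ⊆ LambdaOp A) :
    C ∈ closure {X : H →L[ℂ] K | ∃ (G₁ : H ≃L[ℂ] H) (G₂ : K ≃L[ℂ] K),
      X = (G₂ : K →L[ℂ] K) ∘L A ∘L (G₁.symm : H →L[ℂ] H)} := by
  rw [Metric.mem_closure_iff]
  intro ε hε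
  obtain ⟨V, hV, hCV⟩ := exists_upsilonMem_norm_le_orthogonal C (ε := ε / 4) (by positivity)
  obtain ⟨W, hW, hξ⟩ := h ⟨V, hV, rfl⟩
  obtain ⟨G₁, G₂, hG, hG'⟩ :=
    exists_orbit_eq_on_norm_le_orthogonal hV hW hξ (η := ε / 4) (by positivity)
  refine ⟨_, ⟨G₁, G₂, rfl⟩, ?_⟩
  have := hV.1.completeSpace_coe
  rw [dist_eq_norm]
  refine lt_of_le_of_lt (ContinuousLinearMap.opNorm_le_bound _ (M := ε / 2) (by positivity)
    fun x => ?_) (half_lt_self hε)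
  have hx : x = V.starProjection x + Vᗮ.starProjection x :=
    (V.starProjection_add_starProjection_orthogonal x).symm
  have hy : Vᗮ.starProjection x ∈ Vᗮ := Submodule.starProjection_apply_mem _ _
  have hXC : (C - (G₂ : K →L[ℂ] K) ∘L A ∘L (G₁.symm : H →L[ℂ] H)) x =
      C (Vᗮ.starProjection x) - G₂ (A (G₁.symm (Vᗮ.starProjection x))) := by
    conv_lhs => rw [hx]
    simp [hG _ (Submodule.starProjection_apply_mem V x)]
  have hnorm : ‖Vᗮ.starProjection x‖ ≤ ‖x‖ := Submodule.norm_starProjection_apply_le _ _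
  rw [hXC]
  refine (norm_sub_le _ _).trans ?_
  linarith [hCV _ hy, hG' _ hy, mul_le_mul_of_nonneg_left hnorm hε.le]
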